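/- Let n be a prime and let g_1 and g_2 be two integers whose residue classes both generate the group of units (Z/nZ)*. Let C be a real circulant matrix of order n, and set A = Q_{g_1} · C and B = Q_{g_2} · C. Then A and B have the same set of complex eigenvalues. In particular, taking g_2 with g_1·g_2 ≡ 1 (mod n), the matrices Q_{g_1}·C and Q_{g_1^{-1}}·C have the same eigenvalues. -/

import Mathlib

open Finset in
/-- Running a weight `w` once along an orbit of a primitive root `g` meets every nonzero element. -/
lemma prod_range_orderOf_mul {F R : Type*} [Field F] [Fintype F] [DecidableEq F] [CommMonoid R]
    {g : F} (hg : orderOf g = Fintype.card F - 1) (w : F → R) {k : F} (hk : k ≠ 0) :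
    ∏ j ∈ range (Fintype.card F - 1), w (g ^ j * k) = ∏ x ∈ univ.erase 0, w x := by
  have hg0 : g ≠ 0 := by
    rintro rfl
    have := Fintype.one_lt_card (α := F)
    rw [orderOf_zero] at hg
    omega
  have hinj : Set.InjOn (fun j => g ^ j * k) (range (Fintype.card F - 1)) := by
    intro i hi j hj hij
    simp only [coe_range, Set.mem_Iio, ← hg] at hi hj
    exact pow_injOn_Iio_orderOf hi hj (mul_right_cancel₀ hk hij)
  have himage : (range (Fintype.card F - 1)).image (fun j => g ^ j * k) = univ.erase 0 := by
    apply eq_of_subset_of_card_le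
    · intro x hx
      obtain ⟨j, -, rfl⟩ := mem_image.1 hx
      simp [hg0, hk]
    · rw [card_image_of_injOn hinj, card_erase_of_mem (mem_univ _), card_univ, card_range]
  rw [← himage, prod_image hinj]

open Finset in
/-- The eigenvalues of a weighted shift along multiplication by a primitive root `g`: they depend
on the weight only. -/
lemma exists_ne_zero_mul_eq_iff {F K : Type*} [Field F] [Fintype F] [DecidableEq F] [Field K]
    {g : F} (hg : orderOf g = Fintype.card F - 1) (w : F → K) (μ : K) :
    (∃ f : F → K, f ≠ 0 ∧ ∀ k, μ * f (g * k) = w k * f k) ↔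
      μ = w 0 ∨ μ ^ (Fintype.card F - 1) = ∏ x ∈ univ.erase 0, w x := by
  have hm : 0 < Fintype.card F - 1 := by
    have := Fintype.one_lt_card (α := F)
    omega
  have hgm : g ^ (Fintype.card F - 1) = 1 := hg ▸ pow_orderOf_eq_one g
  have hg0 : g ≠ 0 := by
    rintro rfl
    rw [zero_pow hm.ne'] at hgm
    exact zero_ne_one hgm
  constructor
  · rintro ⟨f, hf, h⟩
    obtain ⟨k, hk⟩ := Function.ne_iff.1 hf
    rcases eq_or_ne k 0 with rfl | hk0
    · left
      have := h 0
      rw [mul_zero] at this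
      exact mul_right_cancel₀ hk this
    · right
      have hiter (i : ℕ) : μ ^ i * f (g ^ i * k) = (∏ j ∈ range i, w (g ^ j * k)) * f k := by
        induction i with
        | zero => simp
        | succ i ih =>
          rw [prod_range_succ, pow_succ', pow_succ', mul_assoc g]
          linear_combination μ ^ i * h (g ^ i * k) + w (g ^ i * k) * ih
      have := hiter (Fintype.card F - 1)
      rw [hgm, one_mul, prod_range_orderOf_mul hg w hk0] at this
      exact mul_right_cancel₀ hk this
  · rintro (rfl | h)
    · refine ⟨Pi.single 0 1, by simp, fun k => ?_⟩
      rcases eq_or_ne k 0 with rfl | hk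
      · simp
      · simp [hk, hg0]
    · rcases eq_or_ne μ 0 with rfl | hμ
      · rw [zero_pow hm.ne', eq_comm, prod_eq_zero_iff] at h
        obtain ⟨x, -, hx⟩ := h
        refine ⟨Pi.single x 1, by simp, fun k => ?_⟩
        rcases eq_or_ne k x with rfl | hk
        · simp [hx]
        · simp [hk]
      · set a : ℕ → K := fun i => (μ ^ i)⁻¹ * ∏ j ∈ range i, w (g ^ j) with ha
        have ha0 : a 0 = 1 := by simp [ha]
        have ham : a (Fintype.card F - 1) = 1 := by
          have := prod_range_orderOf_mul hg w one_ne_zero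
          simp only [mul_one] at this
          simp only [ha]
          rw [this, ← h, inv_mul_cancel₀ (pow_ne_zero _ hμ)]
        have hsucc (i : ℕ) : w (g ^ i) * a i = μ * a (i + 1) := by
          simp only [ha, prod_range_succ, pow_succ]
          field_simp
        refine ⟨fun k => ∑ i ∈ range (Fintype.card F - 1), if k = g ^ i then a i else 0, ?_, ?_⟩
        · refine Function.ne_iff.2 ⟨1, ?_⟩
          rw [sum_eq_single_of_mem 0 (mem_range.2 hm)]
          · simp [ha0]
          · intro i hi hi0
            rw [if_neg]
            intro hi1
            rw [mem_range, ← hg] at hi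
            exact pow_ne_one_of_lt_orderOf hi0 hi hi1.symm
        · intro k
          have hshift (i : ℕ) : w k * (if k = g ^ i then a i else 0) =
              μ * if g * k = g ^ (i + 1) then a (i + 1) else 0 := by
            simp only [pow_succ' g, mul_right_inj' hg0]
            split_ifs with hk
            · rw [hk, hsucc]
            · simp
          simp only [mul_sum (a := w k), hshift]
          rw [← mul_sum]
          congr 1
          have h₁ := sum_range_succ (fun i => if g * k = g ^ i then a i else 0)
            (Fintype.card F - 1)
          rw [sum_range_succ'] at h₁
          simp only [hgm, ham, pow_zero, ha0] at h₁
          exact (add_right_cancel h₁).symm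

lemma Matrix.mem_spectrum_iff_exists_mulVec {K ι : Type*} [Field K] [Fintype ι] [DecidableEq ι]
    (M : Matrix ι ι K) (μ : K) : μ ∈ spectrum K M ↔ ∃ v, v ≠ 0 ∧ M.mulVec v = μ • v := by
  rw [← Matrix.spectrum_toLin', ← Module.End.hasEigenvalue_iff_mem_spectrum]
  constructor
  · intro h
    obtain ⟨v, hv⟩ := h.exists_hasEigenvector
    exact ⟨v, hv.2, by simpa using hv.apply_eq_smul⟩
  · rintro ⟨v, hv, h⟩
    exact Module.End.hasEigenvalue_of_hasEigenvector (x := v)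
      ⟨Module.End.mem_eigenspace_iff.2 (by simpa using h), hv⟩

open ZMod in
/-- The discrete Fourier transform turns a `g`-circulant matrix into a weighted shift. -/
lemma dft_gcirculant_mulVec {n : ℕ} [NeZero n] {g : ZMod n} (hg : IsUnit g) (c : ZMod n → ℂ)
    {C Q : Matrix (ZMod n) (ZMod n) ℂ} (hC : ∀ i j, C i j = c (j - i))
    (hQ : ∀ i j, Q i j = if j = g * i then 1 else 0) (v : ZMod n → ℂ) (k : ZMod n) :
    𝓕 ((Q * C).mulVec v) (g * k) = 𝓕 c (-k) * 𝓕 v k := by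
  have hQC (i j : ZMod n) : (Q * C) i j = c (j - g * i) := by
    simp [Matrix.mul_apply, hQ, hC]
  simp only [dft_apply, Matrix.mulVec, dotProduct, hQC, smul_eq_mul]
  calc ∑ i, stdAddChar (-(i * (g * k))) * ∑ j, c (j - g * i) * v j
      = ∑ i, stdAddChar (-(i * k)) * ∑ j, c (j - i) * v j :=
        Fintype.sum_equiv hg.unit.mulLeft _ _ fun i => by
          simp only [Units.mulLeft_apply, IsUnit.unit_spec]
          congr 3
          ring
    _ = ∑ j, ∑ i, stdAddChar (-(i * k)) * (c (j - i) * v j) := by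
        simp only [Finset.mul_sum]
        exact Finset.sum_comm
    _ = ∑ j, ∑ m, stdAddChar (-(m * -k)) * c m * (stdAddChar (-(j * k)) * v j) := by
        refine Finset.sum_congr rfl fun j _ => Fintype.sum_equiv (Equiv.subLeft j) _ _ fun i => ?_
        have : (stdAddChar (-(i * k)) : ℂ) =
            stdAddChar (-((j - i) * -k)) * stdAddChar (-(j * k)) := by
          rw [← AddChar.map_add_eq_mul]
          congr 1
          ring
        simp only [Equiv.subLeft_apply, this]
        ring
    _ = _ := by
        rw [Finset.sum_mul_sum, Finset.sum_comm]

open ZMod in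
/-- The eigenvalues of a `g`-circulant matrix of prime order, for `g` a primitive root. -/
lemma mem_spectrum_gcirculant_iff {n : ℕ} [Fact n.Prime] {g : ZMod n} (hg : orderOf g = n - 1)
    (c : ZMod n → ℂ) {C Q : Matrix (ZMod n) (ZMod n) ℂ} (hC : ∀ i j, C i j = c (j - i))
    (hQ : ∀ i j, Q i j = if j = g * i then 1 else 0) (μ : ℂ) :
    μ ∈ spectrum ℂ (Q * C) ↔
      μ = 𝓕 c 0 ∨ μ ^ (n - 1) = ∏ x ∈ Finset.univ.erase 0, 𝓕 c (-x) := by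
  have hg0 : IsUnit g := by
    refine IsUnit.of_pow_eq_one (pow_orderOf_eq_one g) ?_
    have := (Fact.out : n.Prime).two_le
    omega
  have key := exists_ne_zero_mul_eq_iff (g := g) (by rwa [ZMod.card]) (fun x => 𝓕 c (-x)) μ
  simp only [ZMod.card, neg_zero] at key
  rw [Matrix.mem_spectrum_iff_exists_mulVec, ← key]
  have heigen (v : ZMod n → ℂ) :
      (Q * C).mulVec v = μ • v ↔ ∀ k, μ * 𝓕 v (g * k) = 𝓕 c (-k) * 𝓕 v k := by
    rw [← (dft (N := n) (E := ℂ)).injective.eq_iff, _root_.map_smul, funext_iff,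
      ← hg0.unit.mulLeft.forall_congr_right]
    refine forall_congr' fun k => ?_
    rw [Units.mulLeft_apply, IsUnit.unit_spec, dft_gcirculant_mulVec hg0 c hC hQ,
      Pi.smul_apply, smul_eq_mul, eq_comm]
  simp only [heigen]
  constructor
  · rintro ⟨v, hv, h⟩
    exact ⟨𝓕 v, by simpa using hv, h⟩
  · rintro ⟨f, hf, h⟩
    exact ⟨𝓕⁻ f, by simpa using hf, by simpa using h⟩

/-- Let `n` be prime and `g₁, g₂` integers whose residue classes both
generate `(ZMod n)ˣ`.  If `C` is a real circulant matrix of order `n`, then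
`A = Q_{g₁} ⬝ C` and `B = Q_{g₂} ⬝ C` have the same set of complex eigenvalues.
(In particular, taking `g₂` with `g₁·g₂ ≡ 1 (mod n)`, the matrices `Q_{g₁} ⬝ C` and
`Q_{g₁⁻¹} ⬝ C` have the same eigenvalues.) -/
theorem gcirc_same_spectrum_of_generators
    (n : ℕ) [Fact n.Prime] (g₁ g₂ : ℤ)
    (hg₁ : orderOf ((g₁ : ZMod n)) = n - 1)
    (hg₂ : orderOf ((g₂ : ZMod n)) = n - 1)
    (cvec : ZMod n → ℝ)
    (C : Matrix (ZMod n) (ZMod n) ℂ)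
    (hC : ∀ i j : ZMod n, C i j = (cvec (j - i) : ℂ))
    (Q₁ Q₂ : Matrix (ZMod n) (ZMod n) ℂ)
    (hQ₁ : ∀ i j : ZMod n, Q₁ i j = if j = (g₁ : ZMod n) * i then 1 else 0)
    (hQ₂ : ∀ i j : ZMod n, Q₂ i j = if j = (g₂ : ZMod n) * i then 1 else 0) :
    spectrum ℂ (Q₁ * C) = spectrum ℂ (Q₂ * C) := by
  ext μ
  rw [mem_spectrum_gcirculant_iff hg₁ (fun x => (cvec x : ℂ)) hC hQ₁,
    mem_spectrum_gcirculant_iff hg₂ (fun x => (cvec x : ℂ)) hC hQ₂]
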